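/- For the elephant random walk remembering the first and the most recent step: (i) S_n/n converges in distribution, as n → ∞, to the two-point law S taking the value (2p−1)/(3−2p) with probability p and the value −(2p−1)/(3−2p) with probability 1−p; (ii) E(S_n/n) → (2p−1)²/(3−2p) and Var(S_n/n) → 4p(1−p)(2p−1)²/(3−2p)² as n → ∞; (iii) for every r > 0, E((S_n/n)^r) → E(S^r), since |S_n/n| ≤ 1 for all n. -/

import Mathlib

open MeasureTheory ProbabilityTheory Filter Topology

noncomputable section

/-- The σ-algebra generated by the steps `X 1, …, X n`. -/
def sigmaUpTo {Ω : Type*} (X : ℕ → Ω → ℝ) (n : ℕ) : MeasurableSpace Ω :=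
  ⨆ i ∈ Finset.Icc 1 n, MeasurableSpace.comap (X i) inferInstance

/-- The σ-algebra generated by all the steps `X 1, X 2, …`. -/
def sigmaAll {Ω : Type*} (X : ℕ → Ω → ℝ) : MeasurableSpace Ω :=
  ⨆ i ∈ Set.Ici 1, MeasurableSpace.comap (X i) inferInstance

/-- The partial sum `X 1 + ⋯ + X n` of the walk. -/
def partialSum {Ω : Type*} (X : ℕ → Ω → ℝ) (n : ℕ) (ω : Ω) : ℝ :=
  ∑ k ∈ Finset.Icc 1 n, X k ω

/-- Convergence in distribution of the random variables `f n` to the law `ν`,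
expressed as weak convergence tested against bounded continuous functions. -/
def TendstoInDistribution {Ω : Type*} [MeasurableSpace Ω] (μ : Measure Ω)
    (f : ℕ → Ω → ℝ) (ν : Measure ℝ) : Prop :=
  ∀ g : BoundedContinuousFunction ℝ ℝ,
    Tendsto (fun n => ∫ ω, g (f n ω) ∂μ) atTop (𝓝 (∫ x, g x ∂ν))

section Auxiliary

variable {Ω : Type*}

lemma measurable_sigmaUpTo (X : ℕ → Ω → ℝ) {i n : ℕ} (hi : 1 ≤ i) (hin : i ≤ n) :
    Measurable[sigmaUpTo X n] (X i) :=
  Measurable.mono (comap_measurable (X i))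
    (le_iSup₂_of_le i (Finset.mem_Icc.2 ⟨hi, hin⟩) le_rfl) le_rfl

/-- The innovation `X (k+2) - E[X (k+2) | X 1, …, X (k+1)]`, where `a = 2p - 1`. -/
def innovation (a : ℝ) (X : ℕ → Ω → ℝ) (k : ℕ) (ω : Ω) : ℝ :=
  X (k + 2) ω - a * (X 1 ω + X (k + 1) ω) / 2

lemma sum_innovation (a : ℝ) (X : ℕ → Ω → ℝ) (n : ℕ) (ω : Ω) :
    ∑ k ∈ Finset.range n, innovation a X k ω =
      (1 - a / 2) * partialSum X n ω - a / 2 * n * X 1 ω - X 1 ω + X (n + 1) ω := by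
  induction n with
  | zero => simp [partialSum]
  | succ n ih =>
    have hS : partialSum X (n + 1) ω = partialSum X n ω + X (n + 1) ω :=
      Finset.sum_Icc_succ_top (by omega) _
    rw [Finset.sum_range_succ, ih, hS, innovation]
    push_cast
    ring

variable [MeasurableSpace Ω] {μ : Measure Ω}

/-- Partial sums of a square-integrable sequence, each term of which is orthogonal to the sum of
its predecessors, have second moment growing at most linearly. -/
lemma integral_sq_sum_range_le {D : ℕ → Ω → ℝ} {C : ℝ} (hD : ∀ k, MemLp (D k) 2 μ)
    (hC : ∀ k, ∫ ω, D k ω ^ 2 ∂μ ≤ C)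
    (horth : ∀ n, ∫ ω, (∑ k ∈ Finset.range n, D k ω) * D n ω ∂μ = 0) (n : ℕ) :
    ∫ ω, (∑ k ∈ Finset.range n, D k ω) ^ 2 ∂μ ≤ C * n := by
  induction n with
  | zero => simp
  | succ n ih =>
    have hM : MemLp (fun ω => ∑ k ∈ Finset.range n, D k ω) 2 μ :=
      memLp_finsetSum _ fun k _ => hD k
    have hMD : Integrable (fun ω => (∑ k ∈ Finset.range n, D k ω) * D n ω) μ :=
      hM.integrable_mul (hD n)
    have hsplit : ∫ ω, (∑ k ∈ Finset.range (n + 1), D k ω) ^ 2 ∂μ =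
        ∫ ω, (∑ k ∈ Finset.range n, D k ω) ^ 2 ∂μ +
          2 * ∫ ω, (∑ k ∈ Finset.range n, D k ω) * D n ω ∂μ + ∫ ω, D n ω ^ 2 ∂μ := by
      have hexp : ∀ ω, (∑ k ∈ Finset.range (n + 1), D k ω) ^ 2 =
          (∑ k ∈ Finset.range n, D k ω) ^ 2 + 2 * ((∑ k ∈ Finset.range n, D k ω) * D n ω) +
            D n ω ^ 2 := fun ω => by
        rw [Finset.sum_range_succ]
        ring
      simp_rw [hexp]
      rw [integral_add (by exact hM.integrable_sq.add (hMD.const_mul 2)) (hD n).integrable_sq,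
        integral_add hM.integrable_sq (hMD.const_mul 2), integral_const_mul]
    rw [hsplit, horth]
    push_cast
    linarith [hC n]

/-- Mean-square convergence implies convergence of the integrals of bounded continuous functions. -/
lemma tendsto_integral_boundedContinuousFunction_of_tendsto_integral_sq [IsProbabilityMeasure μ]
    {f : ℕ → Ω → ℝ} {Z : Ω → ℝ} (hf : ∀ n, MemLp (f n) 2 μ) (hZ : MemLp Z 2 μ)
    (h : Tendsto (fun n => ∫ ω, (f n ω - Z ω) ^ 2 ∂μ) atTop (𝓝 0))
    (g : BoundedContinuousFunction ℝ ℝ) :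
    Tendsto (fun n => ∫ ω, g (f n ω) ∂μ) atTop (𝓝 (∫ ω, g (Z ω) ∂μ)) := by
  have hLp : Tendsto (fun n => eLpNorm (f n - Z) 2 μ) atTop (𝓝 0) := by
    have hnorm : ∀ n, eLpNorm (f n - Z) 2 μ =
        ENNReal.ofReal ((∫ ω, (f n ω - Z ω) ^ 2 ∂μ) ^ (2⁻¹ : ℝ)) := fun n => by
      rw [((hf n).sub hZ).eLpNorm_eq_integral_rpow_norm (by norm_num) (by norm_num)]
      simp
    simp_rw [hnorm]
    simpa using ENNReal.tendsto_ofReal (h.rpow_const (p := (2⁻¹ : ℝ)) (by norm_num))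
  have hmeas : TendstoInMeasure μ f atTop Z :=
    tendstoInMeasure_of_tendsto_eLpNorm two_ne_zero (fun n => (hf n).1) hZ.1 hLp
  have hdist := (hmeas.tendstoInDistribution fun n => (hf n).1.aemeasurable).tendsto
  have := ProbabilityMeasure.tendsto_iff_forall_integral_tendsto.1 hdist g
  simp only [ProbabilityMeasure.coe_mk] at this
  rw [integral_map hZ.1.aemeasurable g.continuous.aestronglyMeasurable] at this
  refine this.congr fun n => ?_
  rw [integral_map (hf n).1.aemeasurable g.continuous.aestronglyMeasurable]

/-- The expectation of a function of a `±1`-valued random variable. -/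
lemma integral_comp_of_ae_eq_one_or_neg_one [IsProbabilityMeasure μ] {Y : Ω → ℝ} {p : ℝ}
    (hY : Measurable Y) (hp : 0 ≤ p) (hval : ∀ᵐ ω ∂μ, Y ω = 1 ∨ Y ω = -1)
    (hone : μ {ω | Y ω = 1} = ENNReal.ofReal p) (h : ℝ → ℝ) :
    ∫ ω, h (Y ω) ∂μ = p * h 1 + (1 - p) * h (-1) := by
  have hs : MeasurableSet {ω | Y ω = 1} := hY (measurableSet_singleton 1)
  have hae : (fun ω => h (Y ω)) =ᵐ[μ]
      fun ω => {ω | Y ω = 1}.indicator (fun _ => h 1 - h (-1)) ω + h (-1) := by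
    filter_upwards [hval] with ω hω
    rcases hω with hω | hω
    · simp [hω]
    · have : (-1 : ℝ) ≠ 1 := by norm_num
      simp [hω, this]
  rw [integral_congr_ae hae,
    integral_add ((integrable_const _).indicator hs) (integrable_const _),
    integral_indicator_const _ hs, measureReal_def, hone, ENNReal.toReal_ofReal hp]
  simp
  ring

lemma sigmaUpTo_le {X : ℕ → Ω → ℝ} (hX : ∀ i, Measurable (X i)) (n : ℕ) :
    sigmaUpTo X n ≤ ‹MeasurableSpace Ω› :=
  iSup₂_le fun i _ => (hX i).comap_le

lemma memLp_of_ae_eq_one_or_neg_one [IsFiniteMeasure μ] {Y : Ω → ℝ} (hY : Measurable Y)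
    (hval : ∀ᵐ ω ∂μ, Y ω = 1 ∨ Y ω = -1) : MemLp Y 2 μ := by
  refine MemLp.of_bound hY.aestronglyMeasurable 1 ?_
  filter_upwards [hval] with ω hω
  rcases hω with hω | hω <;> simp [hω]

/-- If the conditional mean of `X (n+2)` is `a (X 1 + X (n+1)) / 2`, its innovation is orthogonal to
the sum of the previous ones. -/
lemma integral_sum_innovation_mul_innovation [IsFiniteMeasure μ] {X : ℕ → Ω → ℝ} {a : ℝ}
    (hXmeas : ∀ i, Measurable (X i)) (hX : ∀ i, 1 ≤ i → MemLp (X i) 2 μ) {n : ℕ}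
    (hcond : μ[X (n + 2) | sigmaUpTo X (n + 1)] =ᵐ[μ]
      fun ω => a * (X 1 ω + X (n + 1) ω) / 2) :
    ∫ ω, (∑ k ∈ Finset.range n, innovation a X k ω) * innovation a X n ω ∂μ = 0 := by
  have hle := sigmaUpTo_le hXmeas (n + 1)
  set M : Ω → ℝ := fun ω => ∑ k ∈ Finset.range n, innovation a X k ω
  set L : Ω → ℝ := fun ω => a * (X 1 ω + X (n + 1) ω) / 2 with hL
  have hLmem : MemLp L 2 μ := by
    have := ((hX 1 le_rfl).add (hX (n + 1) (by omega))).const_mul (a / 2)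
    convert this using 2 with ω
    simp only [hL, Pi.add_apply]
    ring
  have hMmem : MemLp M 2 μ := memLp_finsetSum _ fun k _ => by
    have := (hX (k + 2) (by omega)).sub
      (((hX 1 le_rfl).add (hX (k + 1) (by omega))).const_mul (a / 2))
    convert this using 1
    ext ω
    simp only [innovation, Pi.add_apply, Pi.sub_apply]
    ring
  have hMmeas : StronglyMeasurable[sigmaUpTo X (n + 1)] M := by
    refine Measurable.stronglyMeasurable (Finset.measurable_sum _ fun k hk => ?_)
    have hk := Finset.mem_range.1 hk
    exact (measurable_sigmaUpTo X (by omega) (by omega)).sub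
      ((((measurable_sigmaUpTo X le_rfl (by omega)).add
        (measurable_sigmaUpTo X (by omega) (by omega))).const_mul a).div_const 2)
  have hMX : Integrable (M * X (n + 2)) μ := hMmem.integrable_mul (hX (n + 2) (by omega))
  have hML : Integrable (M * L) μ := hMmem.integrable_mul hLmem
  have hpull := condExp_mul_of_stronglyMeasurable_left hMmeas hMX
    ((hX (n + 2) (by omega)).integrable one_le_two)
  have hEq : ∫ ω, (M * X (n + 2)) ω ∂μ = ∫ ω, (M * L) ω ∂μ := by
    rw [← integral_condExp hle]
    refine integral_congr_ae ?_
    filter_upwards [hpull, hcond] with ω h₁ h₂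
    rw [h₁, Pi.mul_apply, Pi.mul_apply, h₂]
  calc ∫ ω, M ω * innovation a X n ω ∂μ
      = ∫ ω, ((M * X (n + 2)) ω - (M * L) ω) ∂μ := by
        congr 1 with ω
        simp only [innovation, Pi.mul_apply, hL]
        ring
    _ = 0 := by rw [integral_sub hMX hML, hEq, sub_self]

/-- Mean-square convergence of `S n / n` to `a / (2 - a) * X 1`, with rate. -/
lemma integral_sq_partialSum_div_sub_le [IsProbabilityMeasure μ] {X : ℕ → Ω → ℝ} {a : ℝ}
    (ha : |a| ≤ 1) (hXmeas : ∀ i, Measurable (X i))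
    (hval : ∀ i, 1 ≤ i → ∀ᵐ ω ∂μ, X i ω = 1 ∨ X i ω = -1)
    (hcond : ∀ n, μ[X (n + 2) | sigmaUpTo X (n + 1)] =ᵐ[μ]
      fun ω => a * (X 1 ω + X (n + 1) ω) / 2) {n : ℕ} (hn : 1 ≤ n) :
    ∫ ω, (partialSum X n ω / n - a / (2 - a) * X 1 ω) ^ 2 ∂μ ≤ 64 / (n : ℝ) := by
  obtain ⟨ha₁, ha₂⟩ := abs_le.1 ha
  have hX : ∀ i, 1 ≤ i → MemLp (X i) 2 μ := fun i hi =>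
    memLp_of_ae_eq_one_or_neg_one (hXmeas i) (hval i hi)
  have hDmeas : ∀ k, Measurable (innovation a X k) := fun k =>
    (hXmeas _).sub ((((hXmeas _).add (hXmeas _)).const_mul a).div_const 2)
  have hDbound : ∀ k, ∀ᵐ ω ∂μ, |innovation a X k ω| ≤ 2 := fun k => by
    filter_upwards [hval 1 le_rfl, hval (k + 1) (by omega), hval (k + 2) (by omega)]
      with ω h₁ h₂ h₃
    rw [innovation, abs_le]
    rcases h₁ with h₁ | h₁ <;> rcases h₂ with h₂ | h₂ <;> rcases h₃ with h₃ | h₃ <;>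
      rw [h₁, h₂, h₃] <;> constructor <;> linarith
  have hD : ∀ k, MemLp (innovation a X k) 2 μ := fun k =>
    MemLp.of_bound (hDmeas k).aestronglyMeasurable 2 (hDbound k)
  have hDsq : ∀ k, ∫ ω, innovation a X k ω ^ 2 ∂μ ≤ 4 := fun k => by
    calc ∫ ω, innovation a X k ω ^ 2 ∂μ ≤ ∫ _, (4 : ℝ) ∂μ := by
          refine integral_mono_ae (hD k).integrable_sq (integrable_const _) ?_
          filter_upwards [hDbound k] with ω hω
          nlinarith [abs_le.1 hω]
      _ = 4 := by simp
  have hMsq := integral_sq_sum_range_le hD hDsq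
    (fun n => integral_sum_innovation_mul_innovation hXmeas hX (hcond n)) n
  have hMmem : MemLp (fun ω => ∑ k ∈ Finset.range n, innovation a X k ω) 2 μ :=
    memLp_finsetSum _ fun k _ => hD k
  have hn0 : (1 : ℝ) ≤ n := by exact_mod_cast hn
  calc ∫ ω, (partialSum X n ω / n - a / (2 - a) * X 1 ω) ^ 2 ∂μ
      ≤ ∫ ω, 8 / (n : ℝ) ^ 2 * ((∑ k ∈ Finset.range n, innovation a X k ω) ^ 2 + 4) ∂μ := by
        refine integral_mono_of_nonneg (ae_of_all _ fun ω => sq_nonneg _)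
          ((hMmem.integrable_sq.add (integrable_const _)).const_mul _) ?_
        filter_upwards [hval 1 le_rfl, hval (n + 1) (by omega)] with ω h₁ h₂
        have hsum := sum_innovation a X n ω
        set M := ∑ k ∈ Finset.range n, innovation a X k ω
        have he : (X 1 ω - X (n + 1) ω) ^ 2 ≤ 4 := by
          rcases h₁ with h₁ | h₁ <;> rcases h₂ with h₂ | h₂ <;> rw [h₁, h₂] <;> norm_num
        have hrepr : partialSum X n ω / n - a / (2 - a) * X 1 ω =
            2 / (2 - a) / n * (M + (X 1 ω - X (n + 1) ω)) := by
          have : 2 - a ≠ 0 := by linarith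
          rw [hsum]
          field_simp
          ring
        have hfac : (2 / (2 - a)) ^ 2 ≤ 4 := by
          have h₂ : 2 / (2 - a) ≤ 2 := by
            rw [div_le_iff₀ (by linarith)]
            linarith
          have h₀ : 0 ≤ 2 / (2 - a) := div_nonneg two_pos.le (by linarith)
          nlinarith
        have hsq : (M + (X 1 ω - X (n + 1) ω)) ^ 2 ≤ 2 * (M ^ 2 + 4) := by
          nlinarith [sq_nonneg (M - (X 1 ω - X (n + 1) ω))]
        calc (partialSum X n ω / n - a / (2 - a) * X 1 ω) ^ 2
            = (2 / (2 - a)) ^ 2 * (M + (X 1 ω - X (n + 1) ω)) ^ 2 / (n : ℝ) ^ 2 := by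
              rw [hrepr]
              ring
          _ ≤ 4 * (2 * (M ^ 2 + 4)) / (n : ℝ) ^ 2 := by gcongr
          _ = 8 / (n : ℝ) ^ 2 * (M ^ 2 + 4) := by ring
    _ = 8 / (n : ℝ) ^ 2 * (∫ ω, (∑ k ∈ Finset.range n, innovation a X k ω) ^ 2 ∂μ + 4) := by
        rw [integral_const_mul, integral_add hMmem.integrable_sq (integrable_const _)]
        simp
    _ ≤ 8 / (n : ℝ) ^ 2 * (8 * n) := by
        gcongr
        linarith
    _ = 64 / n := by
        field_simp
        norm_num

lemma ae_abs_partialSum_div_le_one {X : ℕ → Ω → ℝ}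
    (hval : ∀ i, 1 ≤ i → ∀ᵐ ω ∂μ, X i ω = 1 ∨ X i ω = -1) (n : ℕ) :
    ∀ᵐ ω ∂μ, |partialSum X n ω / n| ≤ 1 := by
  have hall : ∀ᵐ ω ∂μ, ∀ i, 1 ≤ i → (X i ω = 1 ∨ X i ω = -1) :=
    ae_all_iff.2 fun i => by
      by_cases hi : 1 ≤ i
      · filter_upwards [hval i hi] with ω hω _ using hω
      · exact ae_of_all _ fun ω h => absurd h hi
  filter_upwards [hall] with ω hω
  have hS : |partialSum X n ω| ≤ n := by
    calc |partialSum X n ω| ≤ ∑ k ∈ Finset.Icc 1 n, |X k ω| := Finset.abs_sum_le_sum_abs _ _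
      _ = ∑ _k ∈ Finset.Icc 1 n, (1 : ℝ) := by
        refine Finset.sum_congr rfl fun k hk => ?_
        rcases hω k (Finset.mem_Icc.1 hk).1 with h | h <;> simp [h]
      _ = n := by simp
  rw [abs_div, Nat.abs_cast]
  exact div_le_one_of_le₀ hS (Nat.cast_nonneg n)

/-- The power function truncated to `[-1, 1]`, as a bounded continuous function. -/
def truncatedPow (r : ℕ) : BoundedContinuousFunction ℝ ℝ :=
  BoundedContinuousFunction.ofNormedAddCommGroup (fun x => max (-1) (min 1 x) ^ r)
    (by fun_prop) 1 fun x => by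
      rw [norm_pow]
      refine pow_le_one₀ (norm_nonneg _) (abs_le.2 ⟨le_max_left _ _, ?_⟩)
      exact max_le (by norm_num) (min_le_left _ _)

lemma truncatedPow_apply_of_abs_le_one {x : ℝ} (hx : |x| ≤ 1) (r : ℕ) :
    truncatedPow r x = x ^ r := by
  obtain ⟨h₁, h₂⟩ := abs_le.1 hx
  change max (-1) (min 1 x) ^ r = x ^ r
  rw [min_eq_right h₂, max_eq_right h₁]

end Auxiliary

/-- for the elephant random walk remembering the first and the most recent
step: (i) `Sₙ/n` converges in distribution to the two-point law `S` with mass `p` at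
`(2p-1)/(3-2p)` and mass `1-p` at `-(2p-1)/(3-2p)`; (ii) `E(Sₙ/n) → (2p-1)²/(3-2p)` and
`Var(Sₙ/n) → 4p(1-p)(2p-1)²/(3-2p)²`; (iii) for every `r > 0`, `E((Sₙ/n)^r) → E(S^r)`. -/
theorem elephant_first_and_last_step_lln
    {Ω : Type*} [MeasurableSpace Ω] (μ : Measure Ω) [IsProbabilityMeasure μ]
    (p : ℝ) (hp0 : 0 < p) (hp1 : p < 1)
    (X : ℕ → Ω → ℝ)
    (hXmeas : ∀ i, Measurable (X i))
    (hval : ∀ i, 1 ≤ i → ∀ᵐ ω ∂μ, X i ω = 1 ∨ X i ω = -1)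
    (hinit : μ {ω | X 1 ω = 1} = ENNReal.ofReal p)
    (hcond1 : μ[X 2 | sigmaUpTo X 1] =ᵐ[μ] fun ω => (2*p-1) * X 1 ω)
    (hcond : ∀ n, 2 ≤ n →
      μ[X (n+1) | sigmaUpTo X n] =ᵐ[μ] fun ω => (2*p-1) * (X 1 ω + X n ω) / 2) :
    TendstoInDistribution μ (fun n ω => partialSum X n ω / n)
      (ENNReal.ofReal p • Measure.dirac ((2*p-1)/(3-2*p)) +
        ENNReal.ofReal (1-p) • Measure.dirac (-((2*p-1)/(3-2*p)))) ∧
    Tendsto (fun n : ℕ => ∫ ω, partialSum X n ω / n ∂μ) atTop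
      (𝓝 ((2*p-1)^2/(3-2*p))) ∧
    Tendsto (fun n : ℕ => variance (fun ω => partialSum X n ω / n) μ) atTop
      (𝓝 (4*p*(1-p)*(2*p-1)^2/(3-2*p)^2)) ∧
    (∀ r : ℕ, 0 < r →
      Tendsto (fun n : ℕ => ∫ ω, (partialSum X n ω / n)^r ∂μ) atTop
        (𝓝 (p * ((2*p-1)/(3-2*p))^r + (1-p) * (-((2*p-1)/(3-2*p)))^r))) := by
  have ha : |2 * p - 1| ≤ 1 := abs_le.2 ⟨by linarith, by linarith⟩
  have hcond' : ∀ n, μ[X (n + 2) | sigmaUpTo X (n + 1)] =ᵐ[μ]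
      fun ω => (2 * p - 1) * (X 1 ω + X (n + 1) ω) / 2 := fun n => by
    rcases n with _ | n
    · filter_upwards [hcond1] with ω hω
      rw [hω]
      ring
    · exact hcond (n + 2) (by omega)
  set c : ℝ := (2 * p - 1) / (3 - 2 * p) with hc
  have hden : 0 < 3 - 2 * p := by linarith
  have hc1 : |c| ≤ 1 := by
    rw [hc, abs_div, abs_of_pos hden, div_le_one hden]
    exact abs_le.2 ⟨by linarith, by linarith⟩
  have hbound := ae_abs_partialSum_div_le_one hval
  have hmeas : ∀ n : ℕ, Measurable fun ω => partialSum X n ω / n := fun n =>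
    (Finset.measurable_sum _ fun k _ => hXmeas k).div_const _
  have hf : ∀ n : ℕ, MemLp (fun ω => partialSum X n ω / n) 2 μ := fun n =>
    MemLp.of_bound (hmeas n).aestronglyMeasurable 1 (hbound n)
  have hZ : MemLp (fun ω => c * X 1 ω) 2 μ :=
    (memLp_of_ae_eq_one_or_neg_one (hXmeas 1) (hval 1 le_rfl)).const_mul c
  have hsq : Tendsto (fun n : ℕ => ∫ ω, (partialSum X n ω / n - c * X 1 ω) ^ 2 ∂μ)
      atTop (𝓝 0) := by
    refine squeeze_zero' (Eventually.of_forall fun n => integral_nonneg fun ω => sq_nonneg _) ?_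
      (tendsto_const_div_atTop_nhds_zero_nat 64)
    filter_upwards [eventually_ge_atTop 1] with n hn
    have := integral_sq_partialSum_div_sub_le ha hXmeas hval hcond' hn
    rwa [show 2 - (2 * p - 1) = 3 - 2 * p by ring] at this
  have hlim : ∀ g : BoundedContinuousFunction ℝ ℝ,
      Tendsto (fun n : ℕ => ∫ ω, g (partialSum X n ω / n) ∂μ) atTop
        (𝓝 (p * g c + (1 - p) * g (-c))) := fun g => by
    have := tendsto_integral_boundedContinuousFunction_of_tendsto_integral_sq hf hZ hsq g
    rw [integral_comp_of_ae_eq_one_or_neg_one (hXmeas 1) hp0.le (hval 1 le_rfl) hinit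
      fun x => g (c * x)] at this
    simpa using this
  have hmoment : ∀ r : ℕ, Tendsto (fun n : ℕ => ∫ ω, (partialSum X n ω / n) ^ r ∂μ) atTop
      (𝓝 (p * c ^ r + (1 - p) * (-c) ^ r)) := fun r => by
    have := hlim (truncatedPow r)
    rw [truncatedPow_apply_of_abs_le_one hc1,
      truncatedPow_apply_of_abs_le_one (by rwa [abs_neg])] at this
    refine this.congr fun n => integral_congr_ae ?_
    filter_upwards [hbound n] with ω hω using truncatedPow_apply_of_abs_le_one hω r
  have hmean : Tendsto (fun n : ℕ => ∫ ω, partialSum X n ω / n ∂μ) atTop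
      (𝓝 ((2*p-1)^2/(3-2*p))) := by
    have := hmoment 1
    simp only [pow_one] at this
    convert this using 2
    rw [hc]
    ring
  refine ⟨fun g => ?_, hmean, ?_, fun r _ => hmoment r⟩
  · have hint : ∀ x : ℝ, ∀ q : ℝ, Integrable g (ENNReal.ofReal q • Measure.dirac x) := fun x q =>
      (g.integrable _).smul_measure ENNReal.ofReal_ne_top
    rw [integral_add_measure (hint _ _) (hint _ _), integral_smul_measure, integral_smul_measure,
      integral_dirac, integral_dirac, ENNReal.toReal_ofReal hp0.le,
      ENNReal.toReal_ofReal (by linarith)]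
    exact hlim g
  · have hvar : ∀ n : ℕ, variance (fun ω => partialSum X n ω / n) μ =
        ∫ ω, (partialSum X n ω / n) ^ 2 ∂μ - (∫ ω, partialSum X n ω / n ∂μ) ^ 2 := fun n => by
      rw [variance_eq_sub (hf n)]
      rfl
    simp_rw [hvar]
    convert (hmoment 2).sub (hmean.pow 2) using 2
    rw [hc]
    field_simp
    ring
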